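/- Assume the anticlustering condition DH holds, γ > 0, and r_n^{γ+1} w_n → ∞. Assume X is either ℓ-dependent (for some ℓ, the σ-algebras σ(X_i : i ≤ k) and σ(X_i : i ≥ k+ℓ+1) are independent for every k) or β-mixing with rates Σ_{j=1}^{r_n} j^γ β_j = o(r_n^{γ+1} w_n²). Then lim_{n→∞} (r_n^{γ+2} w_n²)^{−1} E[(t(N_1) − t(1))^γ 1_{A_1}] = lim_{n→∞} (r_n^{γ+2} w_n²)^{−1} E[L_1^γ 1_{A_1}] = θ²/((γ+1)(γ+2)). -/

import Mathlib

open MeasureTheory ProbabilityTheory Filter Topology Asymptotics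
open scoped Classical

noncomputable section

namespace ClusterPaper

/-- `ℝ^d` with a norm. -/
abbrev Vec (d : ℕ) : Type := EuclideanSpace ℝ (Fin d)

variable {d : ℕ} {Ω : Type*} [MeasureSpace Ω]

/-- Indices of exceedances over the level `1` of a sequence. -/
def excIdx (y : ℤ → Vec d) : Set ℤ := {j : ℤ | 1 < ‖y j‖}

/-- First exceedance index over level `1` (junk value if there is none). -/
def firstExc (y : ℤ → Vec d) : ℤ := sInf (excIdx y)

/-- Last exceedance index over level `1` (junk value if there is none). -/
def lastExc (y : ℤ → Vec d) : ℤ := sSup (excIdx y)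

/-- Cluster length `L(y)` of a sequence: last exceedance index minus first one plus `1`,
and `0` when there is no exceedance over `1`. -/
def clLen (y : ℤ → Vec d) : ℤ :=
  if (excIdx y).Nonempty then lastExc y - firstExc y + 1 else 0

/-- The scaled block: coordinates `1,…,r` are `xn⁻¹ • f (k+1), …, xn⁻¹ • f (k+r)`,
padded with zeros elsewhere (identification of finite vectors with elements of `ℓ₀`). -/
def blk (xn : ℝ) (r : ℕ) (k : ℤ) (f : ℤ → Vec d) : ℤ → Vec d :=
  fun j => if 1 ≤ j ∧ j ≤ (r : ℤ) then xn⁻¹ • f (k + j) else 0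

/-- Exceedance indices over the threshold `xn` among positions `1,…,r`. -/
def excB (xn : ℝ) (r : ℕ) (f : ℤ → Vec d) : Set ℤ :=
  {i : ℤ | 1 ≤ i ∧ i ≤ (r : ℤ) ∧ xn < ‖f i‖}

/-- The event `A₁` : some position in `1,…,r` exceeds the threshold. -/
def A1 (X : ℤ → Ω → Vec d) (xn : ℝ) (r : ℕ) : Set Ω :=
  {ω | (excB xn r (fun i => X i ω)).Nonempty}

/-- First exceedance time `t(1)` in the block `1,…,r`. -/
def tmin (X : ℤ → Ω → Vec d) (xn : ℝ) (r : ℕ) (ω : Ω) : ℤ :=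
  sInf (excB xn r (fun i => X i ω))

/-- Last exceedance time `t(N₁)` in the block `1,…,r`. -/
def tmax (X : ℤ → Ω → Vec d) (xn : ℝ) (r : ℕ) (ω : Ω) : ℤ :=
  sSup (excB xn r (fun i => X i ω))

/-- Cluster length `L₁ = t(N₁) - t(1) + 1` on `A₁`, and `0` off `A₁`. -/
def Len (X : ℤ → Ω → Vec d) (xn : ℝ) (r : ℕ) (ω : Ω) : ℤ :=
  if (excB xn r (fun i => X i ω)).Nonempty then tmax X xn r ω - tmin X xn r ω + 1 else 0

/-- `w_n = P(|X_0| > x_n)`. -/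
def wseq (X : ℤ → Ω → Vec d) (x : ℕ → ℝ) (n : ℕ) : ℝ :=
  (ℙ {ω | x n < ‖X 0 ω‖}).toReal

/-- The candidate extremal index `θ = P(sup_{j ≤ -1} |Y_j| ≤ 1)`. -/
def theta (Y : ℤ → Ω → Vec d) : ℝ :=
  (ℙ {ω | ∀ j : ℤ, j ≤ -1 → ‖Y j ω‖ ≤ 1}).toReal

/-- The cluster index `ν*(H) = E[H(Y) 1{sup_{j ≤ -1} |Y_j| ≤ 1}]`. -/
def nuStar (Y : ℤ → Ω → Vec d) (H : (ℤ → Vec d) → ℝ) : ℝ :=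
  ∫ ω in {ω | ∀ j : ℤ, j ≤ -1 → ‖Y j ω‖ ≤ 1}, H (fun j => Y j ω) ∂ℙ

/-- Stationarity of the time series. -/
def Stationary (X : ℤ → Ω → Vec d) : Prop :=
  ∀ k : ℤ, Measure.map (fun ω => (fun j : ℤ => X (j + k) ω)) ℙ =
    Measure.map (fun ω => (fun j : ℤ => X j ω)) ℙ

/-- `X` admits `Y` as its tail process: for all `i ≤ j` and all bounded continuous
functionals depending only on the coordinates `i,…,j`,
`E[H(x⁻¹ X) | |X_0| > x] → E[H(Y)]` as `x → ∞`. -/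
def IsTailProcess (X Y : ℤ → Ω → Vec d) : Prop :=
  ∀ i j : ℤ, i ≤ j →
    ∀ H : (ℤ → Vec d) → ℝ, Continuous H → (∃ C, ∀ u, |H u| ≤ C) →
      (∀ u v : ℤ → Vec d, (∀ k : ℤ, i ≤ k → k ≤ j → u k = v k) → H u = H v) →
      Tendsto (fun x : ℝ =>
          (∫ ω in {ω | x < ‖X 0 ω‖}, H (fun k => x⁻¹ • X k ω) ∂ℙ) /
            (ℙ {ω | x < ‖X 0 ω‖}).toReal)
        atTop (𝓝 (∫ ω, H (fun k => Y k ω) ∂ℙ))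

/-- Condition `R(r_n, x_n)`. -/
def condR (X : ℤ → Ω → Vec d) (x : ℕ → ℝ) (r : ℕ → ℕ) : Prop :=
  Tendsto x atTop atTop ∧ Tendsto r atTop atTop ∧
    Tendsto (fun n : ℕ => (n : ℝ) * wseq X x n) atTop atTop ∧
    Tendsto (fun n : ℕ => (r n : ℝ) / (n : ℝ)) atTop (𝓝 0) ∧
    Tendsto (fun n : ℕ => (r n : ℝ) * wseq X x n) atTop (𝓝 0)

/-- The anticlustering condition `DH(r_n, x_n)` of Davis and Hsing. -/
def condDH (X : ℤ → Ω → Vec d) (x : ℕ → ℝ) (r : ℕ → ℕ) : Prop :=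
  ∀ s t : ℝ, 0 < s → 0 < t →
    Tendsto (fun ℓ : ℕ =>
      limsup (fun n : ℕ =>
        (ℙ {ω | (∃ j : ℤ, (ℓ : ℤ) ≤ |j| ∧ |j| ≤ (r n : ℤ) ∧ x n * s < ‖X j ω‖) ∧
              x n * t < ‖X 0 ω‖}).toReal /
          (ℙ {ω | x n * t < ‖X 0 ω‖}).toReal) atTop)
      atTop (𝓝 0)

/-- The anticlustering condition `S^(γ)(r_n, x_n)`. -/
def condS (X : ℤ → Ω → Vec d) (x : ℕ → ℝ) (r : ℕ → ℕ) (γ : ℝ) : Prop :=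
  ∀ s t : ℝ, 0 < s → 0 < t →
    Tendsto (fun ℓ : ℕ =>
      limsup (fun n : ℕ =>
        (wseq X x n)⁻¹ * ∑ i ∈ Finset.Icc ℓ (r n),
          (i : ℝ) ^ γ *
            (ℙ {ω | x n * s < ‖X 0 ω‖ ∧ x n * t < ‖X (i : ℤ) ω‖}).toReal) atTop)
      atTop (𝓝 0)

/-- Membership in the class `H(γ)` of cluster functionals:
nonnegative, measurable, a.s. continuous w.r.t. the law of the tail process `Y`,
vanishing when all coordinates are `≤ 1` in norm, depending only on the coordinates
between the first and the last exceedance over `1`, and dominated by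
`C · L(y)^γ` where `L` is the cluster length. -/
structure MemH (Y : ℤ → Ω → Vec d) (γ : ℝ) (H : (ℤ → Vec d) → ℝ) : Prop where
  meas : Measurable H
  nonneg : ∀ y, 0 ≤ H y
  contAE : ∀ᵐ ω ∂ℙ, ContinuousAt H (fun j => Y j ω)
  vanishes : ∀ y : ℤ → Vec d, (∀ j, ‖y j‖ ≤ 1) → H y = 0
  window : ∀ y : ℤ → Vec d, (excIdx y).Nonempty →
      H y = H (fun j => if firstExc y ≤ j ∧ j ≤ lastExc y then y j else 0)
  growth : ∃ C : ℝ, ∀ y, H y ≤ C * (clLen y : ℝ) ^ γ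

/-- The uniform integrability condition
`lim_ℓ limsup_n (r_n w_n)⁻¹ E[H(x_n⁻¹ X_{1,r_n}) 1{H(x_n⁻¹ X_{1,r_n}) > ℓ}] = 0`. -/
def condUI (X : ℤ → Ω → Vec d) (x : ℕ → ℝ) (r : ℕ → ℕ)
    (H : (ℤ → Vec d) → ℝ) : Prop :=
  Tendsto (fun ℓ : ℕ =>
    limsup (fun n : ℕ =>
      (∫ ω in {ω' | (ℓ : ℝ) < H (blk (x n) (r n) 0 (fun i => X i ω'))},
          H (blk (x n) (r n) 0 (fun i => X i ω)) ∂ℙ) /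
        ((r n : ℝ) * wseq X x n)) atTop)
    atTop (𝓝 0)

/-- The β-mixing coefficient between two σ-fields. -/
def betaMix (μ : Measure Ω) (F G : MeasurableSpace Ω) : ℝ :=
  sSup {b : ℝ | ∃ (N M : ℕ) (A : Fin N → Set Ω) (B : Fin M → Set Ω),
    (∀ i, MeasurableSet[F] (A i)) ∧ (∀ j, MeasurableSet[G] (B j)) ∧
    (Pairwise fun i i' => Disjoint (A i) (A i')) ∧
    (Pairwise fun j j' => Disjoint (B j) (B j')) ∧
    (⋃ i, A i) = Set.univ ∧ (⋃ j, B j) = Set.univ ∧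
    b = 2⁻¹ * ∑ i, ∑ j,
      |(μ (A i ∩ B j)).toReal - (μ (A i)).toReal * (μ (B j)).toReal|}

/-- σ-field generated by `X_i`, `i ≤ k`. -/
def sigmaLE (X : ℤ → Ω → Vec d) (k : ℤ) : MeasurableSpace Ω :=
  ⨆ i ∈ {i : ℤ | i ≤ k}, MeasurableSpace.comap (X i) inferInstance

/-- σ-field generated by `X_i`, `i ≥ k`. -/
def sigmaGE (X : ℤ → Ω → Vec d) (k : ℤ) : MeasurableSpace Ω :=
  ⨆ i ∈ {i : ℤ | k ≤ i}, MeasurableSpace.comap (X i) inferInstance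

/-- β-mixing coefficients `β_ℓ` of the series `X`. -/
def betaCoef (X : ℤ → Ω → Vec d) (ℓ : ℕ) : ℝ :=
  betaMix (ℙ : Measure Ω) (sigmaLE X 0) (sigmaGE X (ℓ : ℤ))

/-- `ℓ`-dependence of the series `X`. -/
def LDep (X : ℤ → Ω → Vec d) (ℓ : ℕ) : Prop :=
  ∀ k : ℤ, Indep (sigmaLE X k) (sigmaGE X (k + (ℓ : ℤ) + 1)) ℙ

/-- The mixing condition `β(r_n, ℓ_n)`. -/
def condBeta (X : ℤ → Ω → Vec d) (r : ℕ → ℕ) : Prop :=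
  ∃ ℓ : ℕ → ℕ, Tendsto ℓ atTop atTop ∧
    Tendsto (fun n : ℕ => (ℓ n : ℝ) / (r n : ℝ)) atTop (𝓝 0) ∧
    Tendsto (fun n : ℕ => ((n : ℝ) / (r n : ℝ)) * betaCoef X (ℓ n)) atTop (𝓝 0)

/-- The disjoint-blocks pseudo-estimator `ν̃*_{n}(H)`. -/
def estim (X : ℤ → Ω → Vec d) (x : ℕ → ℝ) (r : ℕ → ℕ)
    (H : (ℤ → Vec d) → ℝ) (n : ℕ) (ω : Ω) : ℝ :=
  (∑ j ∈ Finset.range (n / r n),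
      H (blk (x n) (r n) ((j : ℤ) * (r n : ℤ)) (fun i => X i ω))) /
    ((n : ℝ) * wseq X x n)

/-- The empirical cluster process `G̃_n(H)`. -/
def Gtil (X : ℤ → Ω → Vec d) (x : ℕ → ℝ) (r : ℕ → ℕ)
    (H : (ℤ → Vec d) → ℝ) (n : ℕ) (ω : Ω) : ℝ :=
  (∑ j ∈ Finset.range (n / r n),
      (H (blk (x n) (r n) ((j : ℤ) * (r n : ℤ)) (fun i => X i ω)) -
        ∫ ω', H (blk (x n) (r n) ((j : ℤ) * (r n : ℤ)) (fun i => X i ω')) ∂ℙ)) /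
    Real.sqrt ((n : ℝ) * wseq X x n)

/-- Convergence in distribution to a centered Gaussian law with variance `v`,
tested against bounded continuous functions. -/
def ConvToGaussian (S : ℕ → Ω → ℝ) (v : NNReal) : Prop :=
  ∀ φ : BoundedContinuousFunction ℝ ℝ,
    Tendsto (fun n => ∫ ω, φ (S n ω) ∂ℙ) atTop (𝓝 (∫ z, φ z ∂(gaussianReal 0 v)))

/-- The value `t_j(N_j)^γ · G(𝕏_j)` of the functional `H = T_max^γ · G` on the `j`-th
block (`0`-indexed), equal to `0` if the block has no exceedance. -/
def jumpBlockVal (X : ℤ → Ω → Vec d) (x : ℕ → ℝ) (r : ℕ → ℕ) (γ : ℝ)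
    (G : (ℤ → Vec d) → ℝ) (n j : ℕ) (ω : Ω) : ℝ :=
  if (excB (x n) (r n) (fun i => X ((j : ℤ) * (r n : ℤ) + i) ω)).Nonempty then
    (((sSup (excB (x n) (r n) (fun i => X ((j : ℤ) * (r n : ℤ) + i) ω)) : ℤ) : ℝ) ^ γ) *
      G (blk (x n) (r n) ((j : ℤ) * (r n : ℤ)) (fun i => X i ω))
  else 0


theorem sum_range_rpow_le (p : ℝ) (hp : 0 ≤ p) (m : ℕ) :
    ∑ j ∈ Finset.range m, (j : ℝ) ^ p ≤ (m : ℝ) ^ (p + 1) / (p + 1) := by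
  have hmono : MonotoneOn (fun t : ℝ => t ^ p) (Set.Icc (0 : ℝ) (0 + (m : ℝ))) :=
    fun a ha b _ hab => Real.rpow_le_rpow ha.1 hab hp
  have h := hmono.sum_le_integral
  rw [integral_rpow (Or.inl (by linarith)), Real.zero_rpow (by linarith)] at h
  simpa using h

theorem le_sum_range_succ_rpow (p : ℝ) (hp : 0 ≤ p) (m : ℕ) :
    (m : ℝ) ^ (p + 1) / (p + 1) ≤ ∑ j ∈ Finset.range m, ((j : ℝ) + 1) ^ p := by
  have hmono : MonotoneOn (fun t : ℝ => t ^ p) (Set.Icc (0 : ℝ) (0 + (m : ℝ))) :=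
    fun a ha b _ hab => Real.rpow_le_rpow ha.1 hab hp
  have h := hmono.integral_le_sum
  rw [integral_rpow (Or.inl (by linarith)), Real.zero_rpow (by linarith)] at h
  simpa using h

theorem sum_range_succ_rpow_eq (p : ℝ) (hp : 0 < p) (m : ℕ) :
    ∑ j ∈ Finset.range m, ((j : ℝ) + 1) ^ p
      = ∑ j ∈ Finset.range m, (j : ℝ) ^ p + (m : ℝ) ^ p := by
  rw [← Finset.sum_range_succ (fun j : ℕ => (j : ℝ) ^ p), Finset.sum_range_succ']
  simp [Real.zero_rpow hp.ne']

theorem abs_sum_sub_rpow_le {γ : ℝ} (hγ : 0 < γ) {g : ℕ → ℝ}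
    (hg : ∀ j : ℕ, (j : ℝ) ^ γ ≤ g j) (hg' : ∀ j : ℕ, g j ≤ ((j : ℝ) + 1) ^ γ) (m : ℕ) :
    |∑ j ∈ Finset.range m, g j - (m : ℝ) ^ (γ + 1) / (γ + 1)| ≤ (m : ℝ) ^ γ := by
  have h1 := sum_range_rpow_le γ hγ.le m
  have h2 := le_sum_range_succ_rpow γ hγ.le m
  have h3 := sum_range_succ_rpow_eq γ hγ m
  have h4 := Finset.sum_le_sum (s := Finset.range m) fun j _ => hg j
  have h5 := Finset.sum_le_sum (s := Finset.range m) fun j _ => hg' j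
  rw [abs_le]
  constructor <;> linarith

theorem sum_triangle_eq (g : ℕ → ℝ) (r : ℕ) :
    ∑ i ∈ Finset.range r, ∑ j ∈ Finset.range (r - i), g j
      = ∑ i ∈ Finset.range r, ∑ j ∈ Finset.range (i + 1), g j := by
  rw [← Finset.sum_range_reflect]
  refine Finset.sum_congr rfl fun i hi => ?_
  have := Finset.mem_range.1 hi
  congr 2
  omega

theorem abs_sum_triangle_sub_le {γ : ℝ} (hγ : 0 < γ) {g : ℕ → ℝ}
    (hg : ∀ j : ℕ, (j : ℝ) ^ γ ≤ g j) (hg' : ∀ j : ℕ, g j ≤ ((j : ℝ) + 1) ^ γ) (r : ℕ) :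
    |∑ i ∈ Finset.range r, ∑ j ∈ Finset.range (r - i), g j
        - (r : ℝ) ^ (γ + 2) / ((γ + 1) * (γ + 2))| ≤ 2 * (r : ℝ) ^ (γ + 1) := by
  rw [sum_triangle_eq]
  have hr0 : (0 : ℝ) ≤ r := Nat.cast_nonneg r
  have hpow : (r : ℝ) * (r : ℝ) ^ γ = (r : ℝ) ^ (γ + 1) := by
    rw [Real.rpow_add_one' hr0 (by linarith), mul_comm]
  have h1 : |∑ i ∈ Finset.range r, ∑ j ∈ Finset.range (i + 1), g j
      - ∑ i ∈ Finset.range r, ((i : ℝ) + 1) ^ (γ + 1) / (γ + 1)| ≤ (r : ℝ) ^ (γ + 1) := by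
    rw [← Finset.sum_sub_distrib, ← hpow]
    refine (Finset.abs_sum_le_sum_abs _ _).trans ?_
    refine (Finset.sum_le_card_nsmul (Finset.range r) _ ((r : ℝ) ^ γ) fun i hi => ?_).trans
      (by simp)
    have hi' : ((i + 1 : ℕ) : ℝ) ≤ r := by exact_mod_cast Finset.mem_range.1 hi
    have h := abs_sum_sub_rpow_le hγ hg hg' (i + 1)
    have h' := Real.rpow_le_rpow (Nat.cast_nonneg (i + 1)) hi' hγ.le
    push_cast at h h'
    exact h.trans h'
  have h2 : |∑ i ∈ Finset.range r, ((i : ℝ) + 1) ^ (γ + 1)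
      - (r : ℝ) ^ (γ + 2) / (γ + 2)| ≤ (r : ℝ) ^ (γ + 1) := by
    have h := abs_sum_sub_rpow_le (γ := γ + 1) (by linarith)
      (g := fun j : ℕ => ((j : ℝ) + 1) ^ (γ + 1))
      (fun j => Real.rpow_le_rpow (Nat.cast_nonneg j) (by linarith) (by linarith))
      (fun j => le_rfl) r
    rwa [show γ + 1 + 1 = γ + 2 by ring] at h
  have h3 : |∑ i ∈ Finset.range r, ((i : ℝ) + 1) ^ (γ + 1) / (γ + 1)
      - (r : ℝ) ^ (γ + 2) / ((γ + 1) * (γ + 2))| ≤ (r : ℝ) ^ (γ + 1) := by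
    rw [← Finset.sum_div, mul_comm (γ + 1), ← div_div, ← sub_div, abs_div,
      abs_of_pos (by linarith : 0 < γ + 1)]
    exact (div_le_self (abs_nonneg _) (by linarith)).trans h2
  calc _ ≤ _ := abs_sub_le _ (∑ i ∈ Finset.range r, ((i : ℝ) + 1) ^ (γ + 1) / (γ + 1)) _
    _ ≤ _ := by linarith

theorem rpow_add_two_eq {r : ℝ} (hr : 0 < r) (γ : ℝ) : r ^ (γ + 2) = r ^ γ * r * r := by
  rw [show γ + 2 = γ + 1 + 1 by ring, Real.rpow_add_one hr.ne', Real.rpow_add_one hr.ne']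

theorem tendsto_sum_triangle {γ : ℝ} (hγ : 0 < γ) {g : ℕ → ℝ}
    (hg : ∀ j : ℕ, (j : ℝ) ^ γ ≤ g j) (hg' : ∀ j : ℕ, g j ≤ ((j : ℝ) + 1) ^ γ) :
    Tendsto (fun r : ℕ => (∑ i ∈ Finset.range r, ∑ j ∈ Finset.range (r - i), g j)
      / (r : ℝ) ^ (γ + 2)) atTop (𝓝 (1 / ((γ + 1) * (γ + 2)))) := by
  rw [tendsto_iff_norm_sub_tendsto_zero]
  have hlim : Tendsto (fun r : ℕ => 2 / (r : ℝ)) atTop (𝓝 0) :=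
    tendsto_const_div_atTop_nhds_zero_nat 2
  refine squeeze_zero' (Eventually.of_forall fun _ => norm_nonneg _) ?_ hlim
  filter_upwards [eventually_gt_atTop 0] with r hr
  have hr0 : (0 : ℝ) < r := by exact_mod_cast hr
  have hp : 0 < (r : ℝ) ^ (γ + 2) := Real.rpow_pos_of_pos hr0 _
  have h := abs_sum_triangle_sub_le hγ hg hg' r
  have e : (∑ i ∈ Finset.range r, ∑ j ∈ Finset.range (r - i), g j) / (r : ℝ) ^ (γ + 2)
      - 1 / ((γ + 1) * (γ + 2))
      = (∑ i ∈ Finset.range r, ∑ j ∈ Finset.range (r - i), g j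
        - (r : ℝ) ^ (γ + 2) / ((γ + 1) * (γ + 2))) / (r : ℝ) ^ (γ + 2) := by
    field_simp
  rw [e, Real.norm_eq_abs, abs_div, abs_of_pos hp, div_le_div_iff₀ hp hr0]
  calc _ ≤ 2 * (r : ℝ) ^ (γ + 1) * r := by gcongr
    _ = _ := by rw [rpow_add_two_eq hr0, Real.rpow_add_one hr0.ne']; ring

theorem tendsto_cesaro_abs_sub {r : ℕ → ℕ} (hr : Tendsto r atTop atTop) {α : ℕ → ℕ → ℝ}
    {θ : ℝ} (hα : ∀ n m, |α n m - θ| ≤ 1)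
    (hlim : ∀ ε > 0, ∃ ℓ : ℕ, ∀ᶠ n in atTop, ∀ m, ℓ ≤ m → m < r n → |α n m - θ| ≤ ε) :
    Tendsto (fun n => (∑ m ∈ Finset.range (r n), |α n m - θ|) / (r n : ℝ)) atTop (𝓝 0) := by
  rw [Metric.tendsto_nhds]
  intro ε hε
  obtain ⟨ℓ, hℓ⟩ := hlim (ε / 3) (by positivity)
  have hbig : Tendsto (fun n => (r n : ℝ)) atTop atTop := tendsto_natCast_atTop_atTop.comp hr
  filter_upwards [hℓ, hbig.eventually_gt_atTop (ℓ / (ε / 3)), hbig.eventually_gt_atTop 0]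
    with n hn hn1 hn0
  have hs : ∑ m ∈ Finset.range (r n), |α n m - θ| ≤ ℓ + (r n : ℝ) * (ε / 3) := by
    calc ∑ m ∈ Finset.range (r n), |α n m - θ|
        ≤ ∑ m ∈ Finset.range (r n), ((if m < ℓ then 1 else 0) + ε / 3) := by
          refine Finset.sum_le_sum fun m hm => ?_
          split_ifs with h
          · linarith [hα n m]
          · simpa using hn m (not_lt.1 h) (Finset.mem_range.1 hm)
      _ ≤ ℓ + (r n : ℝ) * (ε / 3) := by
          rw [Finset.sum_add_distrib, Finset.sum_boole]
          simp only [Finset.sum_const, Finset.card_range, nsmul_eq_mul]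
          gcongr
          calc _ ≤ (Finset.range ℓ).card := Finset.card_le_card fun m hm => by
                simpa using (Finset.mem_filter.1 hm).2
            _ = ℓ := Finset.card_range ℓ
  rw [div_lt_iff₀ (by positivity)] at hn1
  rw [Real.dist_eq, sub_zero, abs_of_nonneg (by positivity), div_lt_iff₀ hn0]
  nlinarith

theorem tendsto_weighted_pair_sum {γ : ℝ} (hγ : 0 < γ) {g : ℕ → ℝ}
    (hg : ∀ j : ℕ, (j : ℝ) ^ γ ≤ g j) (hg' : ∀ j : ℕ, g j ≤ ((j : ℝ) + 1) ^ γ)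
    {r : ℕ → ℕ} (hr : Tendsto r atTop atTop) {α : ℕ → ℕ → ℝ} {θ : ℝ}
    (hα0 : ∀ n m, 0 ≤ α n m) (hα1 : ∀ n m, α n m ≤ 1) (hθ0 : 0 ≤ θ) (hθ1 : θ ≤ 1)
    (hlim : ∀ ε > 0, ∃ ℓ : ℕ, ∀ᶠ n in atTop, ∀ m, ℓ ≤ m → m < r n → |α n m - θ| ≤ ε) :
    Tendsto (fun n => (∑ i ∈ Finset.range (r n), ∑ j ∈ Finset.range (r n - i),
        g j * (α n i * α n (r n - i - 1 - j))) / (r n : ℝ) ^ (γ + 2))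
      atTop (𝓝 (θ ^ 2 / ((γ + 1) * (γ + 2)))) := by
  have hces := tendsto_cesaro_abs_sub hr
    (fun n m => abs_le.2 ⟨by linarith [hα0 n m], by linarith [hα1 n m]⟩) hlim
  have hmain := ((tendsto_sum_triangle hγ hg hg').comp hr).const_mul (θ ^ 2)
  rw [mul_one_div] at hmain
  refine hmain.congr_dist ?_
  refine squeeze_zero' (Eventually.of_forall fun _ => dist_nonneg) ?_
    (by simpa using hces.const_mul 2)
  filter_upwards [hr.eventually_gt_atTop 0] with n hn
  have hr0 : (0 : ℝ) < r n := by exact_mod_cast hn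
  set S := ∑ m ∈ Finset.range (r n), |α n m - θ| with hS
  have hgnn : ∀ j, 0 ≤ g j := fun j => (Real.rpow_nonneg (Nat.cast_nonneg j) γ).trans (hg j)
  have hgr : ∀ j < r n, g j ≤ (r n : ℝ) ^ γ := fun j hj =>
    (hg' j).trans (Real.rpow_le_rpow (by positivity) (by exact_mod_cast hj) hγ.le)
  have hpair : ∀ i k, |θ ^ 2 - α n i * α n k| ≤ |α n i - θ| + |α n k - θ| := fun i k => by
    have e : θ ^ 2 - α n i * α n k = -(α n i - θ) * α n k - θ * (α n k - θ) := by ring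
    rw [e]
    refine (abs_sub _ _).trans ?_
    rw [abs_mul, abs_mul, abs_neg, abs_of_nonneg (hα0 n k), abs_of_nonneg hθ0]
    exact add_le_add (mul_le_of_le_one_right (abs_nonneg _) (hα1 n k))
      (mul_le_of_le_one_left (abs_nonneg _) hθ1)
  have hinner : ∀ i ∈ Finset.range (r n), |∑ j ∈ Finset.range (r n - i),
      (θ ^ 2 * g j - g j * (α n i * α n (r n - i - 1 - j)))|
      ≤ (r n : ℝ) ^ γ * (r n * |α n i - θ| + S) := fun i hi => by
    calc _ ≤ ∑ j ∈ Finset.range (r n - i),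
          (r n : ℝ) ^ γ * (|α n i - θ| + |α n (r n - i - 1 - j) - θ|) := by
          refine (Finset.abs_sum_le_sum_abs _ _).trans (Finset.sum_le_sum fun j hj => ?_)
          rw [mul_comm (θ ^ 2), ← mul_sub, abs_mul, abs_of_nonneg (hgnn j)]
          have := Finset.mem_range.1 hj
          exact mul_le_mul (hgr j (by omega)) (hpair _ _) (abs_nonneg _) (by positivity)
      _ = (r n : ℝ) ^ γ * (((r n - i : ℕ) : ℝ) * |α n i - θ|
            + ∑ j ∈ Finset.range (r n - i), |α n j - θ|) := by
          rw [← Finset.mul_sum, Finset.sum_add_distrib,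
            Finset.sum_range_reflect (fun j => |α n j - θ|)]
          simp
      _ ≤ _ := by
          gcongr
          · omega
          · exact Finset.sum_le_sum_of_subset_of_nonneg
              (Finset.range_subset_range.2 (by omega)) fun _ _ _ => abs_nonneg _
  have htot : |θ ^ 2 * ∑ i ∈ Finset.range (r n), ∑ j ∈ Finset.range (r n - i), g j
      - ∑ i ∈ Finset.range (r n), ∑ j ∈ Finset.range (r n - i),
        g j * (α n i * α n (r n - i - 1 - j))| ≤ 2 * ((r n : ℝ) ^ γ * (r n * S)) := by
    rw [Finset.mul_sum, ← Finset.sum_sub_distrib]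
    simp_rw [Finset.mul_sum, ← Finset.sum_sub_distrib]
    refine (Finset.abs_sum_le_sum_abs _ _).trans ((Finset.sum_le_sum hinner).trans_eq ?_)
    rw [← Finset.mul_sum, Finset.sum_add_distrib, ← Finset.mul_sum, ← hS]
    simp
    ring
  have hp : 0 < (r n : ℝ) ^ (γ + 2) := Real.rpow_pos_of_pos hr0 _
  rw [Real.dist_eq, Function.comp_apply, ← mul_div_assoc, ← sub_div, abs_div, abs_of_pos hp,
    div_le_iff₀ hp]
  refine htot.trans_eq ?_
  rw [rpow_add_two_eq hr0]
  field_simp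

/-- The event that `Z 0` exceeds `x` and none of the `m` preceding terms does. -/
def firstAt {α : Type*} (Z : ℤ → α → Vec d) (x : ℝ) (m : ℕ) : Set α :=
  {ω | x < ‖Z 0 ω‖ ∧ ∀ l : ℕ, l < m → ‖Z (-(l + 1)) ω‖ ≤ x}

/-- The event that `Z j` exceeds `x` and none of the `m` following terms does. -/
def lastAt {α : Type*} (Z : ℤ → α → Vec d) (x : ℝ) (j m : ℕ) : Set α :=
  {ω | x < ‖Z j ω‖ ∧ ∀ l : ℕ, l < m → ‖Z (l + 1 + j) ω‖ ≤ x}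

theorem measurableSet_forall_norm_le {α : Type*} {mα : MeasurableSpace α} {f : ℕ → α → Vec d}
    (hf : ∀ l, Measurable (f l)) (x : ℝ) (m : ℕ) :
    MeasurableSet {ω | ∀ l : ℕ, l < m → ‖f l ω‖ ≤ x} := by
  simp only [Set.ofPred_forall]
  exact MeasurableSet.iInter fun l => MeasurableSet.iInter fun _ =>
    measurableSet_le (hf l).norm measurable_const

theorem measurableSet_firstAt {α : Type*} {mα : MeasurableSpace α} {Z : ℤ → α → Vec d}
    (hZ : ∀ j ≤ 0, Measurable (Z j)) (x : ℝ) (m : ℕ) : MeasurableSet (firstAt Z x m) :=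
  (measurableSet_lt measurable_const (hZ 0 le_rfl).norm).inter
    (measurableSet_forall_norm_le (fun _ => hZ _ (by omega)) x m)

theorem measurableSet_lastAt {α : Type*} {mα : MeasurableSpace α} {Z : ℤ → α → Vec d} {j : ℕ}
    (hZ : ∀ i : ℤ, (j : ℤ) ≤ i → Measurable (Z i)) (x : ℝ) (m : ℕ) :
    MeasurableSet (lastAt Z x j m) :=
  (measurableSet_lt measurable_const (hZ j le_rfl).norm).inter
    (measurableSet_forall_norm_le (fun _ => hZ _ (by omega)) x m)

theorem Stationary.measureReal_shift {X : ℤ → Ω → Vec d} (hstat : Stationary X)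
    (hXm : ∀ j, Measurable (X j)) (k : ℤ) {S : Set (ℤ → Vec d)} (hS : MeasurableSet S) :
    (ℙ : Measure Ω).real {ω | (fun j => X (j + k) ω) ∈ S}
      = (ℙ : Measure Ω).real {ω | (fun j => X j ω) ∈ S} := by
  have h := congrArg (fun μ : Measure (ℤ → Vec d) => μ.real S) (hstat k)
  rw [map_measureReal_apply (measurable_pi_lambda _ fun j => hXm (j + k)) hS,
    map_measureReal_apply (measurable_pi_lambda _ hXm) hS] at h
  exact h

theorem Stationary.measureReal_exceed {X : ℤ → Ω → Vec d} (hstat : Stationary X)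
    (hXm : ∀ j, Measurable (X j)) (k : ℤ) (x : ℝ) :
    (ℙ : Measure Ω).real {ω | x < ‖X k ω‖} = (ℙ : Measure Ω).real {ω | x < ‖X 0 ω‖} := by
  have h := hstat.measureReal_shift hXm k (S := {f | x < ‖f 0‖})
    (measurableSet_lt measurable_const (measurable_pi_apply (0 : ℤ)).norm)
  simpa using h

theorem measureReal_firstAt_eq_sub {X : ℤ → Ω → Vec d} [IsProbabilityMeasure (ℙ : Measure Ω)]
    (hstat : Stationary X)
    (hXm : ∀ j, Measurable (X j)) (x : ℝ) (m : ℕ) :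
    (ℙ : Measure Ω).real (firstAt X x m)
      = (ℙ : Measure Ω).real {ω | ∀ l : ℕ, l < m → ‖X l ω‖ ≤ x}
        - (ℙ : Measure Ω).real {ω | ∀ l : ℕ, l < m + 1 → ‖X l ω‖ ≤ x} := by
  have h := hstat.measureReal_shift hXm m
    (measurableSet_firstAt (Z := fun j (f : ℤ → Vec d) => f j)
      (fun j _ => measurable_pi_apply j) x m)
  have hm : MeasurableSet {ω | ∀ l : ℕ, l < m + 1 → ‖X l ω‖ ≤ x} :=
    measurableSet_forall_norm_le (fun _ => hXm _) x (m + 1)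
  have hsub : {ω | ∀ l : ℕ, l < m + 1 → ‖X l ω‖ ≤ x} ⊆ {ω | ∀ l : ℕ, l < m → ‖X l ω‖ ≤ x} :=
    fun ω hω l hl => hω l (hl.trans m.lt_succ_self)
  rw [← measureReal_sdiff hsub hm]
  refine h.symm.trans (congrArg _ ?_)
  ext ω
  simp only [firstAt, Set.mem_ofPred_eq, Set.mem_sdiff, zero_add]
  constructor
  · rintro ⟨h0, h1⟩
    refine ⟨fun l hl => ?_, fun h => (h m m.lt_succ_self).not_gt h0⟩
    have := h1 (m - 1 - l) (by omega)
    rwa [show -(((m - 1 - l : ℕ) : ℤ) + 1) + m = l by omega] at this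
  · rintro ⟨h0, h1⟩
    refine ⟨?_, fun l hl => ?_⟩
    · by_contra! hc
      refine h1 fun l hl => ?_
      rcases (Nat.lt_succ_iff_lt_or_eq.1 hl) with h | rfl
      exacts [h0 l h, hc]
    · have := h0 (m - 1 - l) (by omega)
      rwa [show ((m - 1 - l : ℕ) : ℤ) = -((l : ℤ) + 1) + m by omega] at this

theorem measureReal_lastAt_eq {X : ℤ → Ω → Vec d} [IsProbabilityMeasure (ℙ : Measure Ω)]
    (hstat : Stationary X) (hXm : ∀ j, Measurable (X j)) (x : ℝ) (j m : ℕ) :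
    (ℙ : Measure Ω).real (lastAt X x j m) = (ℙ : Measure Ω).real (firstAt X x m) := by
  have hU : ∀ k : ℕ, MeasurableSet {f : ℤ → Vec d | ∀ l : ℕ, l < k → ‖f l‖ ≤ x} :=
    measurableSet_forall_norm_le (f := fun (l : ℕ) (u : ℤ → Vec d) => u l)
      (fun l => measurable_pi_apply (l : ℤ)) x
  have h1 := hstat.measureReal_shift hXm (j + 1) (hU m)
  have h2 := hstat.measureReal_shift hXm j (hU (m + 1))
  simp only [Set.mem_ofPred_eq] at h1 h2
  rw [measureReal_firstAt_eq_sub hstat hXm, ← h1, ← h2]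
  have hm : MeasurableSet {ω | ∀ l : ℕ, l < m + 1 → ‖X (l + j) ω‖ ≤ x} :=
    measurableSet_forall_norm_le (fun _ => hXm _) x (m + 1)
  have hsub : {ω | ∀ l : ℕ, l < m + 1 → ‖X (l + j) ω‖ ≤ x}
      ⊆ {ω | ∀ l : ℕ, l < m → ‖X (l + (j + 1)) ω‖ ≤ x} := fun ω hω l hl => by
    have := hω (l + 1) (by omega)
    rwa [show ((l + 1 : ℕ) : ℤ) + j = l + (j + 1) by omega] at this
  rw [← measureReal_sdiff hsub hm]
  refine congrArg _ ?_
  ext ω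
  simp only [lastAt, Set.mem_ofPred_eq, Set.mem_sdiff]
  have e : ∀ l : ℕ, (l : ℤ) + 1 + j = l + (j + 1) := fun l => by ring
  simp only [e]
  rw [and_comm]
  refine and_congr_right fun h0 => ⟨fun h hc => ?_, fun h => ?_⟩
  · exact (hc 0 (by omega)).not_gt (by simpa using h)
  · by_contra! hc
    refine h fun l hl => ?_
    rcases l with _ | l
    · simpa using hc
    · have := h0 l (by omega)
      rwa [show ((l + 1 : ℕ) : ℤ) + j = l + (j + 1) by omega]

theorem bddAbove_betaMix_set (μ : Measure Ω) [IsProbabilityMeasure μ] {F G : MeasurableSpace Ω}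
    (hF : F ≤ MeasureSpace.toMeasurableSpace) (hG : G ≤ MeasureSpace.toMeasurableSpace) :
    BddAbove {b : ℝ | ∃ (N M : ℕ) (A : Fin N → Set Ω) (B : Fin M → Set Ω),
      (∀ i, MeasurableSet[F] (A i)) ∧ (∀ j, MeasurableSet[G] (B j)) ∧
      (Pairwise fun i i' => Disjoint (A i) (A i')) ∧
      (Pairwise fun j j' => Disjoint (B j) (B j')) ∧
      (⋃ i, A i) = Set.univ ∧ (⋃ j, B j) = Set.univ ∧
      b = 2⁻¹ * ∑ i, ∑ j,
        |(μ (A i ∩ B j)).toReal - (μ (A i)).toReal * (μ (B j)).toReal|} := by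
  refine ⟨1, ?_⟩
  rintro b ⟨N, M, A, B, hA, hB, hdA, hdB, hUA, hUB, rfl⟩
  have hsumA : ∑ i, μ.real (A i) = 1 := by
    rw [← measureReal_iUnion_fintype hdA fun i => hF _ (hA i), hUA, probReal_univ]
  have hsumB : ∑ j, μ.real (B j) = 1 := by
    rw [← measureReal_iUnion_fintype hdB fun i => hG _ (hB i), hUB, probReal_univ]
  have hAB : ∀ i, ∑ j, μ.real (A i ∩ B j) = μ.real (A i) := fun i => by
    rw [← measureReal_iUnion_fintype
      (fun j j' h => (hdB h).mono Set.inter_subset_right Set.inter_subset_right)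
      fun j => (hF _ (hA i)).inter (hG _ (hB j)), ← Set.inter_iUnion, hUB, Set.inter_univ]
  have hbound : ∑ i, ∑ j, |μ.real (A i ∩ B j) - μ.real (A i) * μ.real (B j)| ≤ 2 := by
    calc _ ≤ ∑ i, ∑ j, (μ.real (A i ∩ B j) + μ.real (A i) * μ.real (B j)) := by
          refine Finset.sum_le_sum fun i _ => Finset.sum_le_sum fun j _ => ?_
          refine (abs_sub _ _).trans_eq ?_
          rw [abs_of_nonneg measureReal_nonneg, abs_of_nonneg (by positivity)]
      _ = 2 := by
          simp_rw [Finset.sum_add_distrib, hAB, ← Finset.mul_sum, hsumB, mul_one, hsumA]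
          norm_num
  change 2⁻¹ * ∑ i, ∑ j, |μ.real (A i ∩ B j) - μ.real (A i) * μ.real (B j)| ≤ 1
  linarith

theorem abs_measureReal_inter_sub_le_betaMix (μ : Measure Ω) [IsProbabilityMeasure μ]
    {F G : MeasurableSpace Ω}
    (hF : F ≤ MeasureSpace.toMeasurableSpace) (hG : G ≤ MeasureSpace.toMeasurableSpace)
    {A B : Set Ω} (hA : MeasurableSet[F] A) (hB : MeasurableSet[G] B) :
    |μ.real (A ∩ B) - μ.real A * μ.real B| ≤ betaMix μ F G := by
  have hmem := le_csSup (bddAbove_betaMix_set μ hF hG)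
    ⟨2, 2, ![A, Aᶜ], ![B, Bᶜ], by simp [Fin.forall_fin_two, hA, hA.compl],
      by simp [Fin.forall_fin_two, hB, hB.compl],
      by
        intro i j hij
        fin_cases i <;> fin_cases j <;>
          simp_all [disjoint_compl_left, disjoint_compl_right],
      by
        intro i j hij
        fin_cases i <;> fin_cases j <;>
          simp_all [disjoint_compl_left, disjoint_compl_right],
      by ext ω; simp [Fin.exists_fin_two, em],
      by ext ω; simp [Fin.exists_fin_two, em], rfl⟩
  refine le_trans ?_ hmem
  have hc : μ.real (A ∩ Bᶜ) - μ.real A * μ.real Bᶜ = -(μ.real (A ∩ B) - μ.real A * μ.real B) := by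
    have h1 := measureReal_inter_add_sdiff (μ := μ) (s := A) (hG _ hB)
    rw [Set.sdiff_eq] at h1
    rw [probReal_compl_eq_one_sub (hG _ hB)]
    linarith
  simp only [Fin.sum_univ_two, Matrix.cons_val_zero, Matrix.cons_val_one]
  simp only [← measureReal_def]
  rw [hc, abs_neg]
  linarith [abs_nonneg (μ.real (Aᶜ ∩ B) - μ.real Aᶜ * μ.real B),
    abs_nonneg (μ.real (Aᶜ ∩ Bᶜ) - μ.real Aᶜ * μ.real Bᶜ)]

theorem measurable_sigmaLE {α : Type*} (X : ℤ → α → Vec d) {i k : ℤ} (h : i ≤ k) :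
    Measurable[sigmaLE X k] (X i) :=
  measurable_iff_comap_le.2
    (le_iSup₂ (f := fun i (_ : i ∈ {i : ℤ | i ≤ k}) => MeasurableSpace.comap (X i) inferInstance)
      i h)

theorem measurable_sigmaGE {α : Type*} (X : ℤ → α → Vec d) {i k : ℤ} (h : k ≤ i) :
    Measurable[sigmaGE X k] (X i) :=
  measurable_iff_comap_le.2
    (le_iSup₂ (f := fun i (_ : i ∈ {i : ℤ | k ≤ i}) => MeasurableSpace.comap (X i) inferInstance)
      i h)

theorem sigmaLE_le {X : ℤ → Ω → Vec d} (hXm : ∀ j, Measurable (X j)) (k : ℤ) :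
    sigmaLE X k ≤ MeasureSpace.toMeasurableSpace :=
  iSup₂_le fun i _ => (hXm i).comap_le

theorem sigmaGE_le {X : ℤ → Ω → Vec d} (hXm : ∀ j, Measurable (X j)) (k : ℤ) :
    sigmaGE X k ≤ MeasureSpace.toMeasurableSpace :=
  iSup₂_le fun i _ => (hXm i).comap_le

theorem abs_cov_le_betaCoef [IsProbabilityMeasure (ℙ : Measure Ω)] {X : ℤ → Ω → Vec d}
    (hXm : ∀ j, Measurable (X j)) (x : ℝ) (i j m : ℕ) :
    |(ℙ : Measure Ω).real (firstAt X x i ∩ lastAt X x j m)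
      - (ℙ : Measure Ω).real (firstAt X x i) * (ℙ : Measure Ω).real (lastAt X x j m)|
      ≤ betaCoef X j :=
  abs_measureReal_inter_sub_le_betaMix _ (sigmaLE_le hXm 0) (sigmaGE_le hXm j)
    (measurableSet_firstAt (mα := sigmaLE X 0) (fun _ h => measurable_sigmaLE X h) x i)
    (measurableSet_lastAt (mα := sigmaGE X j) (fun _ h => measurable_sigmaGE X h) x m)

theorem LDep.measureReal_inter_eq {X : ℤ → Ω → Vec d}
    {ℓ : ℕ} (hdep : LDep X ℓ) (x : ℝ) {i j m : ℕ} (hj : ℓ < j) :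
    (ℙ : Measure Ω).real (firstAt X x i ∩ lastAt X x j m)
      = (ℙ : Measure Ω).real (firstAt X x i) * (ℙ : Measure Ω).real (lastAt X x j m) := by
  have h := (Indep_iff _ _ _).1 (hdep 0) (firstAt X x i) (lastAt X x j m)
    (measurableSet_firstAt (mα := sigmaLE X 0) (fun _ h => measurable_sigmaLE X h) x i)
    (measurableSet_lastAt (mα := sigmaGE X (0 + (ℓ : ℤ) + 1))
      (fun _ h => measurable_sigmaGE X (by omega)) x m)
  simp only [measureReal_def, h, ENNReal.toReal_mul]

theorem measureReal_firstAt_le [IsProbabilityMeasure (ℙ : Measure Ω)] (X : ℤ → Ω → Vec d)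
    (x : ℝ) (m : ℕ) :
    (ℙ : Measure Ω).real (firstAt X x m) ≤ (ℙ : Measure Ω).real {ω | x < ‖X 0 ω‖} :=
  measureReal_mono fun _ hω => hω.1

theorem abs_cov_le_exceed [IsProbabilityMeasure (ℙ : Measure Ω)] (X : ℤ → Ω → Vec d)
    (x : ℝ) (i j m : ℕ) :
    |(ℙ : Measure Ω).real (firstAt X x i ∩ lastAt X x j m)
      - (ℙ : Measure Ω).real (firstAt X x i) * (ℙ : Measure Ω).real (lastAt X x j m)|
      ≤ (ℙ : Measure Ω).real {ω | x < ‖X 0 ω‖} := by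
  have h1 := measureReal_firstAt_le X x i
  have h2 : (ℙ : Measure Ω).real (firstAt X x i ∩ lastAt X x j m)
      ≤ (ℙ : Measure Ω).real (firstAt X x i) := measureReal_mono Set.inter_subset_left
  have h3 : (ℙ : Measure Ω).real (firstAt X x i) * (ℙ : Measure Ω).real (lastAt X x j m)
      ≤ (ℙ : Measure Ω).real (firstAt X x i) :=
    mul_le_of_le_one_right measureReal_nonneg measureReal_le_one
  have h4 : 0 ≤ (ℙ : Measure Ω).real (firstAt X x i ∩ lastAt X x j m) := measureReal_nonneg
  have h5 : 0 ≤ (ℙ : Measure Ω).real (firstAt X x i) * (ℙ : Measure Ω).real (lastAt X x j m) :=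
    mul_nonneg measureReal_nonneg measureReal_nonneg
  rw [abs_le]
  constructor <;> linarith

/-- The continuous ramp equal to `1` on `(-∞, 1]` and to `0` on `[1 + 1 / (k + 1), ∞)`. -/
def ramp (k : ℕ) (t : ℝ) : ℝ := max 0 (min 1 (1 - (k + 1) * (t - 1)))

theorem continuous_ramp (k : ℕ) : Continuous (ramp k) := by
  unfold ramp
  fun_prop

theorem ramp_nonneg (k : ℕ) (t : ℝ) : 0 ≤ ramp k t := le_max_left _ _

theorem ramp_le_one (k : ℕ) (t : ℝ) : ramp k t ≤ 1 :=
  max_le zero_le_one (min_le_left _ _)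

theorem ramp_eq_one {k : ℕ} {t : ℝ} (ht : t ≤ 1) : ramp k t = 1 := by
  have : 1 ≤ 1 - ((k : ℝ) + 1) * (t - 1) := by nlinarith [(Nat.cast_nonneg k : (0 : ℝ) ≤ k)]
  simp [ramp, min_eq_left this]

theorem ramp_eq_zero {k : ℕ} {t : ℝ} (ht : 1 + 1 / ((k : ℝ) + 1) ≤ t) : ramp k t = 0 := by
  have hk : (0 : ℝ) < k + 1 := by positivity
  have h : 1 ≤ ((k : ℝ) + 1) * (t - 1) := by
    rw [← div_le_iff₀' hk]
    linarith
  exact max_eq_left ((min_le_right _ _).trans (by linarith))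

theorem eventually_ramp_eq_zero {t : ℝ} (ht : 1 < t) : ∀ᶠ k : ℕ in atTop, ramp k t = 0 := by
  have h := (tendsto_one_div_add_atTop_nhds_zero_nat (𝕜 := ℝ)).eventually_lt_const (sub_pos.2 ht)
  filter_upwards [h] with k hk
  exact ramp_eq_zero (by linarith)

/-- A continuous minorant of the indicator that the value at time `0` exceeds
`1 + 1 / (k + 1)`. -/
def currentRamp (k : ℕ) (u : ℤ → Vec d) : ℝ := 1 - ramp k (‖u 0‖ - 1 / ((k : ℝ) + 1))

/-- A continuous majorant of the indicator that the `m` values before time `0` are at most `1`. -/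
def pastRamp (m k : ℕ) (u : ℤ → Vec d) : ℝ :=
  ∏ l ∈ Finset.range m, ramp k ‖u (-((l : ℤ) + 1))‖

theorem continuous_currentRamp (k : ℕ) : Continuous (currentRamp (d := d) k) :=
  continuous_const.sub ((continuous_ramp k).comp (by fun_prop))

theorem currentRamp_nonneg (k : ℕ) (u : ℤ → Vec d) : 0 ≤ currentRamp k u :=
  sub_nonneg.2 (ramp_le_one _ _)

theorem currentRamp_le_one (k : ℕ) (u : ℤ → Vec d) : currentRamp k u ≤ 1 :=
  sub_le_self _ (ramp_nonneg _ _)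

theorem abs_currentRamp_le_one (k : ℕ) (u : ℤ → Vec d) : |currentRamp k u| ≤ 1 :=
  (abs_of_nonneg (currentRamp_nonneg k u)).trans_le (currentRamp_le_one k u)

theorem continuous_pastRamp (m k : ℕ) : Continuous (pastRamp (d := d) m k) :=
  continuous_finsetProd _ fun l _ => (continuous_ramp k).comp (by fun_prop)

theorem pastRamp_nonneg (m k : ℕ) (u : ℤ → Vec d) : 0 ≤ pastRamp m k u :=
  Finset.prod_nonneg fun _ _ => ramp_nonneg _ _

theorem pastRamp_le_one (m k : ℕ) (u : ℤ → Vec d) : pastRamp m k u ≤ 1 :=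
  Finset.prod_le_one (fun _ _ => ramp_nonneg _ _) fun _ _ => ramp_le_one _ _

theorem abs_pastRamp_le_one (m k : ℕ) (u : ℤ → Vec d) : |pastRamp m k u| ≤ 1 :=
  (abs_of_nonneg (pastRamp_nonneg m k u)).trans_le (pastRamp_le_one m k u)

theorem pastRamp_eq_one {m k : ℕ} {u : ℤ → Vec d}
    (h : ∀ l : ℕ, l < m → ‖u (-((l : ℤ) + 1))‖ ≤ 1) : pastRamp m k u = 1 :=
  Finset.prod_eq_one fun l hl => ramp_eq_one (h l (Finset.mem_range.1 hl))

theorem pastRamp_eq_zero {m k l : ℕ} {u : ℤ → Vec d} (hl : l < m)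
    (h : ramp k ‖u (-((l : ℤ) + 1))‖ = 0) : pastRamp m k u = 0 :=
  Finset.prod_eq_zero (Finset.mem_range.2 hl) h

theorem setIntegral_le_measureReal_inter {μ : Measure Ω} [IsProbabilityMeasure μ] {S T : Set Ω}
    (hT : MeasurableSet T) {h : Ω → ℝ} (hm : Measurable h)
    (h0 : ∀ ω, 0 ≤ h ω) (h1 : ∀ ω, h ω ≤ 1) (hT0 : ∀ ω, ω ∉ T → h ω = 0) :
    ∫ ω in S, h ω ∂μ ≤ μ.real (T ∩ S) := by
  rw [← measureReal_restrict_apply hT, ← integral_indicator_one hT]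
  refine integral_mono ?_ ((integrable_const (1 : ℝ)).indicator hT) fun ω => ?_
  · exact Integrable.of_bound hm.aestronglyMeasurable 1
      (Eventually.of_forall fun ω => by rw [Real.norm_eq_abs, abs_of_nonneg (h0 ω)]; exact h1 ω)
  · by_cases hω : ω ∈ T
    · simpa [hω] using h1 ω
    · simp [hω, hT0 ω hω]

theorem measureReal_inter_le_setIntegral {μ : Measure Ω} [IsProbabilityMeasure μ] {S T : Set Ω}
    (hT : MeasurableSet T) {h : Ω → ℝ} (hm : Measurable h)
    (h0 : ∀ ω, 0 ≤ h ω) (h1 : ∀ ω, h ω ≤ 1) (hT1 : ∀ ω ∈ T, h ω = 1) :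
    μ.real (T ∩ S) ≤ ∫ ω in S, h ω ∂μ := by
  rw [← measureReal_restrict_apply hT, ← integral_indicator_one hT]
  refine integral_mono ((integrable_const (1 : ℝ)).indicator hT) ?_ fun ω => ?_
  · exact Integrable.of_bound hm.aestronglyMeasurable 1
      (Eventually.of_forall fun ω => by rw [Real.norm_eq_abs, abs_of_nonneg (h0 ω)]; exact h1 ω)
  · by_cases hω : ω ∈ T
    · simp [hω, hT1 ω hω]
    · simpa [hω] using h0 ω

theorem norm_inv_smul_vec {x : ℝ} (hx : 0 < x) (v : Vec d) : ‖x⁻¹ • v‖ = ‖v‖ / x := by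
  rw [norm_smul, norm_inv, Real.norm_eq_abs, abs_of_pos hx, div_eq_inv_mul]

theorem exists_eventually_le_measureReal_exceed [IsProbabilityMeasure (ℙ : Measure Ω)]
    {X Y : ℤ → Ω → Vec d} (hXm : ∀ j, Measurable (X j)) (hYm : ∀ j, Measurable (Y j))
    (htail : IsTailProcess X Y) (hY0 : ∀ᵐ ω ∂ℙ, 1 < ‖Y 0 ω‖) {δ : ℝ} (hδ : 0 < δ) :
    ∃ k : ℕ, ∀ᶠ x : ℝ in atTop, (1 - δ) * (ℙ : Measure Ω).real {ω | x < ‖X 0 ω‖}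
      ≤ (ℙ : Measure Ω).real {ω | x * (1 + 1 / ((k : ℝ) + 1)) < ‖X 0 ω‖} := by
  have hlim : Tendsto (fun k => ∫ ω, currentRamp k (fun j => Y j ω) ∂ℙ) atTop (𝓝 1) := by
    have h := tendsto_integral_of_dominated_convergence (μ := (ℙ : Measure Ω))
      (F := fun k ω => currentRamp k (fun j => Y j ω)) (f := fun _ => (1 : ℝ)) (fun _ => (1 : ℝ))
      (fun k => ((continuous_currentRamp k).measurable.comp
        (measurable_pi_lambda _ hYm)).aestronglyMeasurable)
      (integrable_const _)
      (fun k => Eventually.of_forall fun ω => abs_currentRamp_le_one _ _) ?_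
    · simpa using h
    · filter_upwards [hY0] with ω hω
      refine tendsto_const_nhds.congr' ?_
      have hk := (tendsto_one_div_add_atTop_nhds_zero_nat (𝕜 := ℝ)).eventually_lt_const
        (half_pos (sub_pos.2 hω))
      filter_upwards [hk] with k hk
      simp only [currentRamp]
      rw [ramp_eq_zero (by linarith), sub_zero]
  obtain ⟨k, hk⟩ := (hlim.eventually_const_lt (by linarith : 1 - δ < 1)).exists
  refine ⟨k, ?_⟩
  have ht := htail 0 0 le_rfl (currentRamp k) (continuous_currentRamp k)
    ⟨1, abs_currentRamp_le_one k⟩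
    (fun u v h => by simp only [currentRamp, h 0 le_rfl le_rfl])
  filter_upwards [ht.eventually_const_lt hk, eventually_gt_atTop 0] with x hx hx0
  have hle : ∫ ω in {ω | x < ‖X 0 ω‖}, currentRamp k (fun j => x⁻¹ • X j ω) ∂ℙ
      ≤ (ℙ : Measure Ω).real {ω | x * (1 + 1 / ((k : ℝ) + 1)) < ‖X 0 ω‖} := by
    refine (setIntegral_le_measureReal_inter
      (T := {ω | x * (1 + 1 / ((k : ℝ) + 1)) < ‖X 0 ω‖})
      (measurableSet_lt measurable_const (hXm 0).norm)
      ((continuous_currentRamp k).measurable.comp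
        (measurable_pi_lambda _ fun j => (hXm j).const_smul x⁻¹))
      (fun ω => currentRamp_nonneg k _) (fun ω => currentRamp_le_one k _) fun ω hω => ?_).trans
      (measureReal_mono Set.inter_subset_left)
    have hω' : ‖X 0 ω‖ / x ≤ 1 + 1 / ((k : ℝ) + 1) := (div_le_iff₀' hx0).2 (not_lt.1 hω)
    change currentRamp k (fun j => x⁻¹ • X j ω) = 0
    rw [currentRamp, norm_inv_smul_vec hx0, ramp_eq_one (by linarith), sub_self]
  rcases (measureReal_nonneg (μ := (ℙ : Measure Ω)) (s := {ω | x < ‖X 0 ω‖})).eq_or_lt with h | h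
  · rw [← h, mul_zero]
    exact measureReal_nonneg
  · exact ((lt_div_iff₀ h).1 hx).le.trans hle

theorem tendsto_measureReal_firstAt_div [IsProbabilityMeasure (ℙ : Measure Ω)]
    {X Y : ℤ → Ω → Vec d} (hXm : ∀ j, Measurable (X j)) (hYm : ∀ j, Measurable (Y j))
    (hstat : Stationary X) (htail : IsTailProcess X Y) (hY0 : ∀ᵐ ω ∂ℙ, 1 < ‖Y 0 ω‖) (m : ℕ) :
    Tendsto (fun x : ℝ => (ℙ : Measure Ω).real (firstAt X x m)
        / (ℙ : Measure Ω).real {ω | x < ‖X 0 ω‖}) atTop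
      (𝓝 ((ℙ : Measure Ω).real {ω | ∀ l : ℕ, l < m → ‖Y (-(l + 1)) ω‖ ≤ 1})) := by
  set P : Measure Ω := ℙ with hP
  set T : Set Ω := {ω | ∀ l : ℕ, l < m → ‖Y (-(l + 1)) ω‖ ≤ 1} with hT
  have hTm : MeasurableSet T := measurableSet_forall_norm_le (fun _ => hYm _) 1 m
  have htailH : ∀ k, Tendsto (fun x : ℝ =>
      (∫ ω in {ω | x < ‖X 0 ω‖}, pastRamp m k (fun j => x⁻¹ • X j ω) ∂P) / P.real {ω | x < ‖X 0 ω‖})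
      atTop (𝓝 (∫ ω, pastRamp m k (fun j => Y j ω) ∂P)) := fun k =>
    htail (-m) 0 (by omega) (pastRamp m k) (continuous_pastRamp m k)
      ⟨1, abs_pastRamp_le_one m k⟩
      (fun u v h => Finset.prod_congr rfl fun l hl => by
        have := Finset.mem_range.1 hl
        rw [h _ (by omega) (by omega)])
  have hYlim : Tendsto (fun k => ∫ ω, pastRamp m k (fun j => Y j ω) ∂P) atTop (𝓝 (P.real T)) := by
    rw [← integral_indicator_one hTm]
    refine tendsto_integral_of_dominated_convergence (fun _ => (1 : ℝ))
      (fun k => ((continuous_pastRamp m k).measurable.comp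
        (measurable_pi_lambda _ hYm)).aestronglyMeasurable)
      (integrable_const _)
      (fun k => Eventually.of_forall fun ω => abs_pastRamp_le_one m _ _) ?_
    refine Eventually.of_forall fun ω => tendsto_const_nhds.congr' ?_
    by_cases hω : ω ∈ T
    · exact Eventually.of_forall fun k => by
        simp only [pastRamp_eq_one (u := fun j => Y j ω) hω, Set.indicator_of_mem hω, Pi.one_apply]
    · have hω' := hω
      simp only [hT, Set.mem_ofPred_eq, not_forall, not_le] at hω'
      obtain ⟨l, hl, hlt⟩ := hω'
      filter_upwards [eventually_ramp_eq_zero hlt] with k hk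
      simpa [hω] using (pastRamp_eq_zero (u := fun j => Y j ω) hl hk).symm
  have hYge : ∀ k, P.real T ≤ ∫ ω, pastRamp m k (fun j => Y j ω) ∂P := fun k => by
    have h := measureReal_inter_le_setIntegral (μ := P) (S := Set.univ) hTm
      ((continuous_pastRamp m k).measurable.comp (measurable_pi_lambda _ hYm))
        (fun ω => pastRamp_nonneg m k _)
      (fun ω => pastRamp_le_one m k _) (fun ω hω => pastRamp_eq_one (u := fun j => Y j ω) hω)
    simpa using h
  have hupper : ∀ k, ∀ x > 0, P.real (firstAt X x m)
      ≤ ∫ ω in {ω | x < ‖X 0 ω‖}, pastRamp m k (fun j => x⁻¹ • X j ω) ∂P := fun k x hx => by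
    have hsub : firstAt X x m
        ⊆ {ω | ∀ l : ℕ, l < m → ‖X (-((l : ℤ) + 1)) ω‖ ≤ x} ∩ {ω | x < ‖X 0 ω‖} :=
      fun ω hω => ⟨hω.2, hω.1⟩
    refine (measureReal_mono hsub).trans
      (measureReal_inter_le_setIntegral (measurableSet_forall_norm_le (fun _ => hXm _) x m)
      ((continuous_pastRamp m k).measurable.comp
        (measurable_pi_lambda _ fun j => (hXm j).const_smul x⁻¹))
      (fun ω => pastRamp_nonneg m k _) (fun ω => pastRamp_le_one m k _) fun ω hω =>
        pastRamp_eq_one (u := fun j => x⁻¹ • X j ω) fun l hl => ?_)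
    rw [norm_inv_smul_vec hx, div_le_one hx]
    exact hω l hl
  have hlower : ∀ k : ℕ, ∀ x > 0,
      ∫ ω in {ω | x < ‖X 0 ω‖}, pastRamp m k (fun j => x⁻¹ • X j ω) ∂P
      ≤ P.real (firstAt X x m) + m * (P.real {ω | x < ‖X 0 ω‖}
        - P.real {ω | x * (1 + 1 / ((k : ℝ) + 1)) < ‖X 0 ω‖}) := fun k x hx => by
    set y := x * (1 + 1 / ((k : ℝ) + 1)) with hy
    have hxy : x ≤ y := le_mul_of_one_le_right hx.le (by simp; positivity)
    refine (setIntegral_le_measureReal_inter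
      (T := {ω | ∀ l : ℕ, l < m → ‖X (-((l : ℤ) + 1)) ω‖ ≤ y})
      (measurableSet_forall_norm_le (fun _ => hXm _) y m)
      ((continuous_pastRamp m k).measurable.comp
        (measurable_pi_lambda _ fun j => (hXm j).const_smul x⁻¹))
      (fun ω => pastRamp_nonneg m k _) (fun ω => pastRamp_le_one m k _) fun ω hω => ?_).trans ?_
    · simp only [Set.mem_ofPred_eq, not_forall, not_le] at hω
      obtain ⟨l, hl, hlt⟩ := hω
      refine pastRamp_eq_zero (u := fun j => x⁻¹ • X j ω) hl (ramp_eq_zero ?_)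
      rw [norm_inv_smul_vec hx, le_div_iff₀' hx]
      exact hlt.le
    · have hsub : {ω | ∀ l : ℕ, l < m → ‖X (-((l : ℤ) + 1)) ω‖ ≤ y} ∩ {ω | x < ‖X 0 ω‖}
          ⊆ firstAt X x m ∪ ⋃ l ∈ Finset.range m,
            ({ω | x < ‖X (-((l : ℤ) + 1)) ω‖} \ {ω | y < ‖X (-((l : ℤ) + 1)) ω‖}) := by
        rintro ω ⟨h1, h2⟩
        by_cases hω : ω ∈ firstAt X x m
        · exact Or.inl hω
        · right
          have : ∃ l : ℕ, l < m ∧ x < ‖X (-((l : ℤ) + 1)) ω‖ := by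
            by_contra! hc
            exact hω ⟨h2, hc⟩
          obtain ⟨l, hl, hlt⟩ := this
          simp only [Set.mem_iUnion]
          exact ⟨l, Finset.mem_range.2 hl, hlt, not_lt.2 (h1 l hl)⟩
      refine (measureReal_mono hsub).trans ((measureReal_union_le _ _).trans ?_)
      gcongr
      refine (measureReal_biUnion_finset_le _ _).trans ?_
      refine (Finset.sum_le_card_nsmul _ _ _ fun l _ => ?_).trans_eq
        (by rw [Finset.card_range, nsmul_eq_mul])
      have hsub' : {ω | y < ‖X (-((l : ℤ) + 1)) ω‖} ⊆ {ω | x < ‖X (-((l : ℤ) + 1)) ω‖} :=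
        fun ω hω => hxy.trans_lt hω
      rw [measureReal_sdiff hsub' (measurableSet_lt measurable_const (hXm _).norm), hP,
        hstat.measureReal_exceed hXm (-((l : ℤ) + 1)) x,
        hstat.measureReal_exceed hXm (-((l : ℤ) + 1)) y]
  rw [Metric.tendsto_nhds]
  intro ε hε
  obtain ⟨k₁, hk₁⟩ := (hYlim.eventually_lt_const (lt_add_of_pos_right _ hε)).exists
  obtain ⟨k₂, hk₂⟩ := exists_eventually_le_measureReal_exceed hXm hYm htail hY0
    (δ := ε / (2 * (m + 1))) (by positivity)
  filter_upwards [(htailH k₁).eventually_lt_const hk₁, hk₂,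
    (htailH k₂).eventually_const_lt (by linarith [hYge k₂] : P.real T - ε / 2 < _),
    eventually_gt_atTop 0] with x h₁ h₂ h₃ hx
  have hw : 0 ≤ P.real {ω | x < ‖X 0 ω‖} := measureReal_nonneg
  have hu := div_le_div_of_nonneg_right (hupper k₁ x hx) hw
  have hl := div_le_div_of_nonneg_right (hlower k₂ x hx) hw
  rw [add_div] at hl
  have hm : (m * (P.real {ω | x < ‖X 0 ω‖}
      - P.real {ω | x * (1 + 1 / ((k₂ : ℝ) + 1)) < ‖X 0 ω‖})) / P.real {ω | x < ‖X 0 ω‖}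
      ≤ ε / 2 := by
    refine div_le_of_le_mul₀ hw (by positivity) ?_
    calc _ ≤ m * (ε / (2 * (m + 1)) * P.real {ω | x < ‖X 0 ω‖}) := by
          gcongr
          linarith
      _ = (m / (m + 1)) * (ε / 2 * P.real {ω | x < ‖X 0 ω‖}) := by field_simp
      _ ≤ 1 * (ε / 2 * P.real {ω | x < ‖X 0 ω‖}) := by
          gcongr
          rw [div_le_one (by positivity)]
          linarith
      _ = _ := one_mul _
  rw [Real.dist_eq, abs_lt]
  constructor <;> linarith

theorem tendsto_theta [IsProbabilityMeasure (ℙ : Measure Ω)]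
    {Y : ℤ → Ω → Vec d} (hYm : ∀ j, Measurable (Y j)) :
    Tendsto (fun m : ℕ => (ℙ : Measure Ω).real {ω | ∀ l : ℕ, l < m → ‖Y (-(l + 1)) ω‖ ≤ 1})
      atTop (𝓝 (theta Y)) := by
  have h := tendsto_measure_iInter_atTop (μ := (ℙ : Measure Ω))
    (s := fun m : ℕ => {ω | ∀ l : ℕ, l < m → ‖Y (-((l : ℤ) + 1)) ω‖ ≤ 1})
    (fun m => (measurableSet_forall_norm_le (fun _ => hYm _) 1 m).nullMeasurableSet)
    (fun a b hab ω hω l hl => hω l (hl.trans_le hab)) ⟨0, measure_ne_top _ _⟩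
  have he : (⋂ m : ℕ, {ω | ∀ l : ℕ, l < m → ‖Y (-((l : ℤ) + 1)) ω‖ ≤ 1})
      = {ω | ∀ j : ℤ, j ≤ -1 → ‖Y j ω‖ ≤ 1} := by
    ext ω
    simp only [Set.mem_iInter, Set.mem_ofPred_eq]
    refine ⟨fun h j hj => ?_, fun h m l _ => h _ (by omega)⟩
    have := h ((-j).toNat + 1) ((-j).toNat - 1) (by omega)
    rwa [show -((((-j).toNat - 1 : ℕ) : ℤ) + 1) = j by omega] at this
  rw [he] at h
  exact (ENNReal.tendsto_toReal (measure_ne_top _ _)).comp h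

theorem exists_eventually_abs_firstAt_sub_theta_le [IsProbabilityMeasure (ℙ : Measure Ω)]
    {X Y : ℤ → Ω → Vec d} (hXm : ∀ j, Measurable (X j)) (hYm : ∀ j, Measurable (Y j))
    (hstat : Stationary X) (htail : IsTailProcess X Y) (hY0 : ∀ᵐ ω ∂ℙ, 1 < ‖Y 0 ω‖)
    {x : ℕ → ℝ} {r : ℕ → ℕ} (hx : Tendsto x atTop atTop) (hDH : condDH X x r)
    {ε : ℝ} (hε : 0 < ε) :
    ∃ ℓ : ℕ, ∀ᶠ n in atTop, ∀ m, ℓ ≤ m → m < r n →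
      |(ℙ : Measure Ω).real (firstAt X (x n) m) / wseq X x n - theta Y| ≤ ε := by
  have hDH1 := hDH 1 1 one_pos one_pos
  obtain ⟨ℓ, hℓ, hθ⟩ := ((hDH1.eventually_lt_const (by positivity : 0 < ε / 3)).and
    (Metric.tendsto_nhds.1 (tendsto_theta hYm) (ε / 3) (by positivity))).exists
  have hbdd : IsBoundedUnder (· ≤ ·) atTop fun n : ℕ =>
      (ℙ {ω | (∃ j : ℤ, (ℓ : ℤ) ≤ |j| ∧ |j| ≤ (r n : ℤ) ∧ x n * 1 < ‖X j ω‖) ∧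
        x n * 1 < ‖X 0 ω‖}).toReal / (ℙ {ω | x n * 1 < ‖X 0 ω‖}).toReal :=
    isBoundedUnder_of ⟨1, fun n => div_le_one_of_le₀
      (measureReal_mono (μ := (ℙ : Measure Ω)) fun ω hω => hω.2) measureReal_nonneg⟩
  have hq := eventually_lt_of_limsup_lt hℓ hbdd
  have ha := Metric.tendsto_nhds.1
    ((tendsto_measureReal_firstAt_div hXm hYm hstat htail hY0 ℓ).comp hx) (ε / 3) (by positivity)
  refine ⟨ℓ, ?_⟩
  filter_upwards [hq, ha] with n hq ha m hm hmr
  simp only [mul_one] at hq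
  simp only [Function.comp_apply] at ha
  change |_ / (ℙ : Measure Ω).real {ω | x n < ‖X 0 ω‖} - _| ≤ _
  change (ℙ : Measure Ω).real _ / (ℙ : Measure Ω).real {ω | x n < ‖X 0 ω‖} < _ at hq
  set w := (ℙ : Measure Ω).real {ω | x n < ‖X 0 ω‖} with hw
  have hw0 : 0 ≤ w := measureReal_nonneg
  have h1 : (ℙ : Measure Ω).real (firstAt X (x n) m) / w
      ≤ (ℙ : Measure Ω).real (firstAt X (x n) ℓ) / w :=
    div_le_div_of_nonneg_right
      (measureReal_mono fun ω hω => ⟨hω.1, fun l hl => hω.2 l (hl.trans_le hm)⟩) hw0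
  have h2 : (ℙ : Measure Ω).real (firstAt X (x n) ℓ) / w
      ≤ (ℙ : Measure Ω).real (firstAt X (x n) m) / w + ε / 3 := by
    refine le_trans ?_ (add_le_add_right hq.le _)
    rw [← add_div]
    refine div_le_div_of_nonneg_right ((measureReal_mono ?_).trans (measureReal_union_le _ _)) hw0
    intro ω hω
    by_cases hωm : ω ∈ firstAt X (x n) m
    · exact Or.inl hωm
    · right
      have : ∃ l : ℕ, l < m ∧ x n < ‖X (-((l : ℤ) + 1)) ω‖ := by
        by_contra! hc
        exact hωm ⟨hω.1, hc⟩
      obtain ⟨l, hl, hlt⟩ := this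
      have hlℓ : ℓ ≤ l := by
        by_contra! hc
        exact (hω.2 l hc).not_gt hlt
      have habs : |-((l : ℤ) + 1)| = l + 1 := by rw [abs_neg, abs_of_nonneg (by omega)]
      exact ⟨⟨_, by omega, by omega, hlt⟩, hω.1⟩
  rw [Real.dist_eq, abs_lt] at hθ ha
  rw [abs_le]
  constructor <;> linarith [hθ.1, hθ.2, ha.1, ha.2]

/-- The event that, within positions `1, …, r`, the first exceedance over `x` is at `i + 1` and the
last one at `i + 1 + j`. -/
def spanAt {α : Type*} (X : ℤ → α → Vec d) (x : ℝ) (r i j : ℕ) : Set α :=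
  firstAt (fun l => X (l + (i + 1))) x i ∩ lastAt (fun l => X (l + (i + 1))) x j (r - i - 1 - j)

theorem measurableSet_spanAt {X : ℤ → Ω → Vec d} (hXm : ∀ j, Measurable (X j)) (x : ℝ)
    (r i j : ℕ) : MeasurableSet (spanAt X x r i j) :=
  (measurableSet_firstAt (fun _ _ => hXm _) x i).inter
    (measurableSet_lastAt (fun _ _ => hXm _) x _)

theorem measureReal_spanAt {X : ℤ → Ω → Vec d} (hstat : Stationary X)
    (hXm : ∀ j, Measurable (X j)) (x : ℝ) (r i j : ℕ) :
    (ℙ : Measure Ω).real (spanAt X x r i j)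
      = (ℙ : Measure Ω).real (firstAt X x i ∩ lastAt X x j (r - i - 1 - j)) :=
  hstat.measureReal_shift hXm (i + 1)
    ((measurableSet_firstAt (Z := fun l (f : ℤ → Vec d) => f l)
      (fun l _ => measurable_pi_apply l) x i).inter
    (measurableSet_lastAt (Z := fun l (f : ℤ → Vec d) => f l)
      (fun l _ => measurable_pi_apply l) x (r - i - 1 - j)))

theorem mem_spanAt_iff {α : Type*} {X : ℤ → α → Vec d} {x : ℝ} {r i j : ℕ} (hi : i < r)
    (hj : j < r - i) {ω : α} :
    ω ∈ spanAt X x r i j ↔ IsLeast (excB x r fun l => X l ω) (i + 1) ∧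
      IsGreatest (excB x r fun l => X l ω) (i + 1 + j) := by
  constructor
  · rintro ⟨⟨h1, h2⟩, h3, h4⟩
    simp only [zero_add] at h1
    beta_reduce at h2 h3 h4
    have hij : (j : ℤ) + (i + 1) = i + 1 + j := by ring
    rw [hij] at h3
    refine ⟨⟨⟨by omega, by omega, h1⟩, ?_⟩, ⟨by omega, by omega, h3⟩, ?_⟩
    · rintro l ⟨hl1, hl2, hl3⟩
      by_contra! hc
      have := h2 (i - l.toNat) (by omega)
      rw [show -(((i - l.toNat : ℕ) : ℤ) + 1) + (i + 1) = l by omega] at this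
      exact this.not_gt hl3
    · rintro l ⟨hl1, hl2, hl3⟩
      by_contra! hc
      have := h4 (l.toNat - (i + 1 + j) - 1) (by omega)
      rw [show ((l.toNat - (i + 1 + j) - 1 : ℕ) : ℤ) + 1 + j + (i + 1) = l by omega] at this
      exact this.not_gt hl3
  · rintro ⟨⟨h1, h2⟩, h3, h4⟩
    refine ⟨⟨?_, fun l hl => ?_⟩, ?_, fun l hl => ?_⟩
    · simpa using h1.2.2
    · by_contra! hc
      have := h2 ⟨by omega, by omega, hc⟩
      omega
    · have := h3.2.2
      rwa [show (i : ℤ) + 1 + j = j + (i + 1) by ring] at this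
    · by_contra! hc
      have := h4 ⟨by omega, by omega, hc⟩
      omega

theorem A1_eq_biUnion {α : Type*} (X : ℤ → α → Vec d) (x : ℝ) (r : ℕ) :
    A1 X x r = ⋃ p ∈ (Finset.range r).sigma fun i => Finset.range (r - i),
      spanAt X x r p.1 p.2 := by
  ext ω
  simp only [Set.mem_iUnion, Finset.mem_sigma, Finset.mem_range, exists_prop]
  constructor
  · intro hω
    have hne : (excB x r fun l => X l ω).Nonempty := hω
    have hbb : BddBelow (excB x r fun l => X l ω) := ⟨1, fun l hl => hl.1⟩
    have hba : BddAbove (excB x r fun l => X l ω) := ⟨r, fun l hl => hl.2.1⟩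
    have hmin : IsLeast (excB x r fun l => X l ω) (sInf (excB x r fun l => X l ω)) :=
      ⟨Int.csInf_mem hne hbb, fun l hl => csInf_le hbb hl⟩
    have hmax : IsGreatest (excB x r fun l => X l ω) (sSup (excB x r fun l => X l ω)) :=
      ⟨Int.csSup_mem hne hba, fun l hl => le_csSup hba hl⟩
    generalize sInf (excB x r fun l => X l ω) = a at hmin
    generalize sSup (excB x r fun l => X l ω) = b at hmax
    have ha1 := hmin.1.1
    have hb2 := hmax.1.2.1
    have hab : a ≤ b := hmin.2 hmax.1
    refine ⟨⟨(a - 1).toNat, (b - a).toNat⟩, ⟨by simp only; omega, by simp only; omega⟩, ?_⟩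
    rw [mem_spanAt_iff (by simp only; omega) (by simp only; omega)]
    rw [show (((a - 1).toNat : ℕ) : ℤ) + 1 = a by omega,
      show a + (((b - a).toNat : ℕ) : ℤ) = b by omega]
    exact ⟨hmin, hmax⟩
  · rintro ⟨p, ⟨hi, hj⟩, hp⟩
    exact ⟨_, ((mem_spanAt_iff hi hj).1 hp).1.1⟩

theorem setIntegral_A1_eq_sum [IsProbabilityMeasure (ℙ : Measure Ω)] {X : ℤ → Ω → Vec d}
    (hstat : Stationary X) (hXm : ∀ j, Measurable (X j)) (x : ℝ) (r : ℕ) (g : ℕ → ℝ)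
    {f : Ω → ℝ} (hf : ∀ ω ∈ A1 X x r, ∀ j : ℕ, tmax X x r ω - tmin X x r ω = j → f ω = g j) :
    ∫ ω in A1 X x r, f ω ∂ℙ = ∑ i ∈ Finset.range r, ∑ j ∈ Finset.range (r - i),
      g j * (ℙ : Measure Ω).real (firstAt X x i ∩ lastAt X x j (r - i - 1 - j)) := by
  have hmem : ∀ p ∈ (Finset.range r).sigma fun i => Finset.range (r - i),
      p.1 < r ∧ p.2 < r - p.1 := fun p hp => by simpa using hp
  have hval : ∀ p ∈ (Finset.range r).sigma fun i => Finset.range (r - i),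
      ∀ ω ∈ spanAt X x r p.1 p.2, f ω = g p.2 := fun p hp ω hω => by
    obtain ⟨hi, hj⟩ := hmem p hp
    obtain ⟨h1, h2⟩ := (mem_spanAt_iff hi hj).1 hω
    refine hf ω ⟨_, h1.1⟩ _ ?_
    rw [tmax, tmin, h1.csInf_eq, h2.csSup_eq]
    ring
  have hdisj : Set.Pairwise ↑((Finset.range r).sigma fun i => Finset.range (r - i))
      (Function.onFun Disjoint fun p : (_ : ℕ) × ℕ => spanAt X x r p.1 p.2) := by
    rintro ⟨i, j⟩ hp ⟨i', j'⟩ hq hne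
    obtain ⟨hi, hj⟩ := hmem _ hp
    obtain ⟨hi', hj'⟩ := hmem _ hq
    refine Set.disjoint_left.2 fun ω hω hω' => hne ?_
    obtain ⟨h1, h2⟩ := (mem_spanAt_iff hi hj).1 hω
    obtain ⟨h1', h2'⟩ := (mem_spanAt_iff hi' hj').1 hω'
    have e1 := h1.unique h1'
    have e2 := h2.unique h2'
    simp only at e1 e2
    obtain rfl : i = i' := by omega
    obtain rfl : j = j' := by omega
    rfl
  rw [A1_eq_biUnion, integral_biUnion_finset _ (fun p _ => measurableSet_spanAt hXm x r p.1 p.2)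
    hdisj, Finset.sum_sigma]
  · refine Finset.sum_congr rfl fun i hi => Finset.sum_congr rfl fun j hj => ?_
    rw [setIntegral_congr_fun (measurableSet_spanAt hXm x r i j)
      (hval ⟨i, j⟩ (Finset.mem_sigma.2 ⟨hi, hj⟩)), setIntegral_const,
      measureReal_spanAt hstat hXm, smul_eq_mul, mul_comm]
  · intro p hp
    exact (integrableOn_const (μ := (ℙ : Measure Ω)) (C := g p.2)).congr_fun
      (fun ω hω => (hval p hp ω hω).symm) (measurableSet_spanAt hXm x r p.1 p.2)

theorem tendsto_setIntegral_A1 [IsProbabilityMeasure (ℙ : Measure Ω)]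
    {X Y : ℤ → Ω → Vec d} (hXm : ∀ j, Measurable (X j)) (hYm : ∀ j, Measurable (Y j))
    (hstat : Stationary X) (htail : IsTailProcess X Y) (hY0 : ∀ᵐ ω ∂ℙ, 1 < ‖Y 0 ω‖)
    {x : ℕ → ℝ} {r : ℕ → ℕ} (hx : Tendsto x atTop atTop) (hr : Tendsto r atTop atTop)
    (hDH : condDH X x r) {γ : ℝ} (hγ : 0 < γ)
    (hlarge : Tendsto (fun n : ℕ => (r n : ℝ) ^ (γ + 1) * wseq X x n) atTop atTop)
    {κ : ℕ → ℕ → ℝ}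
    (hκ : ∀ n i j m, 1 ≤ j →
      |(ℙ : Measure Ω).real (firstAt X (x n) i ∩ lastAt X (x n) j m)
        - (ℙ : Measure Ω).real (firstAt X (x n) i) * (ℙ : Measure Ω).real (lastAt X (x n) j m)|
        ≤ κ n j)
    (hsmall : (fun n : ℕ => ∑ j ∈ Finset.Icc 1 (r n), (j : ℝ) ^ γ * κ n j)
      =o[atTop] fun n : ℕ => (r n : ℝ) ^ (γ + 1) * (wseq X x n) ^ 2)
    {g : ℕ → ℝ} (hg : ∀ j : ℕ, (j : ℝ) ^ γ ≤ g j) (hg' : ∀ j : ℕ, g j ≤ ((j : ℝ) + 1) ^ γ)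
    {f : ℕ → Ω → ℝ} (hf : ∀ n, ∀ ω ∈ A1 X (x n) (r n), ∀ j : ℕ,
      tmax X (x n) (r n) ω - tmin X (x n) (r n) ω = j → f n ω = g j) :
    Tendsto (fun n : ℕ => (∫ ω in A1 X (x n) (r n), f n ω ∂ℙ)
        / ((r n : ℝ) ^ (γ + 2) * (wseq X x n) ^ 2))
      atTop (𝓝 (theta Y ^ 2 / ((γ + 1) * (γ + 2)))) := by
  have hw0 : ∀ n, 0 ≤ wseq X x n := fun n => ENNReal.toReal_nonneg
  have hmain := tendsto_weighted_pair_sum hγ hg hg' hr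
    (α := fun n m => (ℙ : Measure Ω).real (firstAt X (x n) m) / wseq X x n) (θ := theta Y)
    (fun n m => div_nonneg measureReal_nonneg (hw0 n))
    (fun n m => div_le_one_of_le₀ (measureReal_firstAt_le X (x n) m) (hw0 n))
    measureReal_nonneg measureReal_le_one
    (fun ε hε => exists_eventually_abs_firstAt_sub_theta_le hXm hYm hstat htail hY0 hx hDH hε)
  refine hmain.congr_dist ?_
  have hzero : Tendsto (fun n : ℕ => ((r n : ℝ) ^ (γ + 1) * wseq X x n)⁻¹
      + 2 ^ γ * ((∑ j ∈ Finset.Icc 1 (r n), (j : ℝ) ^ γ * κ n j)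
        / ((r n : ℝ) ^ (γ + 1) * (wseq X x n) ^ 2))) atTop (𝓝 0) := by
    simpa using hlarge.inv_tendsto_atTop.add (hsmall.tendsto_div_nhds_zero.const_mul (2 ^ γ))
  refine squeeze_zero' (Eventually.of_forall fun _ => dist_nonneg) ?_ hzero
  filter_upwards [hlarge.eventually_gt_atTop 0, hr.eventually_gt_atTop 0] with n hn hrn
  have hr0 : (0 : ℝ) < r n := by exact_mod_cast hrn
  have hw : 0 < wseq X x n := pos_of_mul_pos_right hn (by positivity)
  have hgnn : ∀ j, 0 ≤ g j := fun j => (Real.rpow_nonneg (Nat.cast_nonneg j) γ).trans (hg j)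
  have hκnn : ∀ j, 1 ≤ j → 0 ≤ κ n j := fun j hj => (abs_nonneg _).trans (hκ n 0 j 0 hj)
  rw [setIntegral_A1_eq_sum hstat hXm (x n) (r n) g (hf n)]
  set w := wseq X x n with hwdef
  set a : ℕ → ℝ := fun m => (ℙ : Measure Ω).real (firstAt X (x n) m) with ha
  set c : ℕ → ℕ → ℝ := fun i j =>
    (ℙ : Measure Ω).real (firstAt X (x n) i ∩ lastAt X (x n) j (r n - i - 1 - j)) with hc
  have hcov : ∀ i j, |a i * a (r n - i - 1 - j) - c i j| ≤ if j = 0 then w else κ n j := by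
    intro i j
    rw [abs_sub_comm, ha, hc]
    simp only
    rw [← measureReal_lastAt_eq hstat hXm (x n) j (r n - i - 1 - j)]
    split_ifs with hj
    · exact abs_cov_le_exceed X (x n) i j _
    · exact hκ n i j _ (Nat.one_le_iff_ne_zero.2 hj)
  have hinner : ∀ i ∈ Finset.range (r n), |∑ j ∈ Finset.range (r n - i),
      (g j * (a i * a (r n - i - 1 - j)) - g j * c i j)|
      ≤ w + 2 ^ γ * ∑ j ∈ Finset.Icc 1 (r n), (j : ℝ) ^ γ * κ n j := by
    intro i _
    calc _ ≤ ∑ j ∈ Finset.range (r n - i), g j * (if j = 0 then w else κ n j) := by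
          refine (Finset.abs_sum_le_sum_abs _ _).trans (Finset.sum_le_sum fun j _ => ?_)
          rw [← mul_sub, abs_mul, abs_of_nonneg (hgnn j)]
          exact mul_le_mul_of_nonneg_left (hcov i j) (hgnn j)
      _ ≤ ∑ j ∈ Finset.range (r n + 1), g j * (if j = 0 then w else κ n j) := by
          refine Finset.sum_le_sum_of_subset_of_nonneg (Finset.range_subset_range.2 (by omega))
            fun j _ _ => mul_nonneg (hgnn j) ?_
          split_ifs with hj
          exacts [hw.le, hκnn j (Nat.one_le_iff_ne_zero.2 hj)]
      _ = g 0 * w + ∑ j ∈ Finset.Icc 1 (r n), g j * κ n j := by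
          rw [Finset.range_eq_Ico, Finset.sum_eq_sum_Ico_succ_bot (by omega)]
          congr 1
          refine Finset.sum_congr (by ext; simp) fun j hj => ?_
          rw [if_neg (by have := (Finset.mem_Icc.1 hj).1; omega)]
      _ ≤ 1 * w + ∑ j ∈ Finset.Icc 1 (r n), 2 ^ γ * ((j : ℝ) ^ γ * κ n j) := by
          refine add_le_add (mul_le_mul_of_nonneg_right (by simpa using hg' 0) hw.le)
            (Finset.sum_le_sum fun j hj => ?_)
          have hj1 := (Finset.mem_Icc.1 hj).1
          have hj1' : (1 : ℝ) ≤ j := by exact_mod_cast hj1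
          rw [← mul_assoc, ← Real.mul_rpow two_pos.le (by positivity)]
          refine mul_le_mul_of_nonneg_right ((hg' j).trans ?_) (hκnn j hj1)
          exact Real.rpow_le_rpow (by positivity) (by linarith) hγ.le
      _ = _ := by rw [one_mul, Finset.mul_sum]
  have hrw : ∑ i ∈ Finset.range (r n), ∑ j ∈ Finset.range (r n - i),
      g j * (a i / w * (a (r n - i - 1 - j) / w))
      = (∑ i ∈ Finset.range (r n), ∑ j ∈ Finset.range (r n - i),
        g j * (a i * a (r n - i - 1 - j))) / w ^ 2 := by
    simp_rw [Finset.sum_div]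
    refine Finset.sum_congr rfl fun i _ => Finset.sum_congr rfl fun j _ => ?_
    field_simp
  have htot : |∑ i ∈ Finset.range (r n), ∑ j ∈ Finset.range (r n - i),
        g j * (a i * a (r n - i - 1 - j))
      - ∑ i ∈ Finset.range (r n), ∑ j ∈ Finset.range (r n - i), g j * c i j|
      ≤ r n * (w + 2 ^ γ * ∑ j ∈ Finset.Icc 1 (r n), (j : ℝ) ^ γ * κ n j) := by
    rw [← Finset.sum_sub_distrib]
    simp_rw [← Finset.sum_sub_distrib]
    refine (Finset.abs_sum_le_sum_abs _ _).trans
      ((Finset.sum_le_card_nsmul _ _ _ hinner).trans_eq ?_)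
    rw [Finset.card_range, nsmul_eq_mul]
  have hp : 0 < (r n : ℝ) ^ (γ + 2) * w ^ 2 := by positivity
  rw [Real.dist_eq, hrw, div_div, mul_comm (w ^ 2), ← sub_div, abs_div, abs_of_pos hp,
    div_le_iff₀ hp]
  refine htot.trans_eq ?_
  rw [rpow_add_two_eq hr0, Real.rpow_add_one hr0.ne']
  have : (r n : ℝ) ^ γ ≠ 0 := (Real.rpow_pos_of_pos hr0 γ).ne'
  field_simp

theorem exists_covariance_bound [IsProbabilityMeasure (ℙ : Measure Ω)] {X : ℤ → Ω → Vec d}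
    (hXm : ∀ j, Measurable (X j)) {x : ℕ → ℝ} {r : ℕ → ℕ} {γ : ℝ}
    (hlarge : Tendsto (fun n : ℕ => (r n : ℝ) ^ (γ + 1) * wseq X x n) atTop atTop)
    (hdep : (∃ ℓ : ℕ, LDep X ℓ) ∨
      ((fun n : ℕ => ∑ j ∈ Finset.Icc 1 (r n), (j : ℝ) ^ γ * betaCoef X j)
        =o[atTop] fun n : ℕ => (r n : ℝ) ^ (γ + 1) * (wseq X x n) ^ 2)) :
    ∃ κ : ℕ → ℕ → ℝ, (∀ n i j m, 1 ≤ j →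
      |(ℙ : Measure Ω).real (firstAt X (x n) i ∩ lastAt X (x n) j m)
        - (ℙ : Measure Ω).real (firstAt X (x n) i) * (ℙ : Measure Ω).real (lastAt X (x n) j m)|
        ≤ κ n j) ∧
      (fun n : ℕ => ∑ j ∈ Finset.Icc 1 (r n), (j : ℝ) ^ γ * κ n j)
        =o[atTop] fun n : ℕ => (r n : ℝ) ^ (γ + 1) * (wseq X x n) ^ 2 := by
  rcases hdep with ⟨ℓ, hℓ⟩ | hβ
  · refine ⟨fun n j => if j ≤ ℓ then wseq X x n else 0, fun n i j m _ => ?_, ?_⟩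
    · beta_reduce
      split_ifs with hj
      · exact abs_cov_le_exceed X (x n) i j m
      · rw [hℓ.measureReal_inter_eq (x n) (not_le.1 hj), sub_self, abs_zero]
    · have hO : (fun n : ℕ => ∑ j ∈ Finset.Icc 1 (r n),
          (j : ℝ) ^ γ * if j ≤ ℓ then wseq X x n else 0) =O[atTop] fun n => wseq X x n := by
        refine IsBigO.of_bound (∑ j ∈ Finset.range (ℓ + 1), (j : ℝ) ^ γ)
          (Eventually.of_forall fun n => ?_)
        have hw0 : 0 ≤ wseq X x n := ENNReal.toReal_nonneg
        have hnn : ∀ j : ℕ, 0 ≤ (j : ℝ) ^ γ * if j ≤ ℓ then wseq X x n else 0 := fun j =>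
          mul_nonneg (by positivity) (by split_ifs <;> simp [hw0])
        rw [Real.norm_eq_abs, abs_of_nonneg (Finset.sum_nonneg fun j _ => hnn j),
          Real.norm_eq_abs, abs_of_nonneg hw0, Finset.sum_mul]
        simp_rw [mul_ite, mul_zero]
        rw [← Finset.sum_filter]
        refine Finset.sum_le_sum_of_subset_of_nonneg (fun j hj => ?_)
          fun j _ _ => by positivity
        have := (Finset.mem_filter.1 hj).2
        exact Finset.mem_range.2 (by omega)
      refine hO.trans_isLittleO ?_
      have h1 : (fun _ : ℕ => (1 : ℝ)) =o[atTop] fun n => (r n : ℝ) ^ (γ + 1) * wseq X x n :=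
        (isLittleO_const_left.2 (Or.inr (tendsto_norm_atTop_atTop.comp hlarge)))
      have h2 := h1.mul_isBigO (isBigO_refl (fun n => wseq X x n) atTop)
      simpa [pow_two, mul_assoc] using h2
  · exact ⟨fun _ j => betaCoef X j, fun n i j m _ => abs_cov_le_betaCoef hXm (x n) i j m, hβ⟩

/-- Large blocks: under `DH`, `γ > 0`, `r_n^{γ+1} w_n → ∞`, and `X` either `ℓ`-dependent
or β-mixing with `Σ_{j≤r_n} j^γ β_j = o(r_n^{γ+1} w_n²)`,
`(r_n^{γ+2} w_n²)⁻¹ E[(t(N₁)−t(1))^γ 1_{A₁}]` and `(r_n^{γ+2} w_n²)⁻¹ E[L₁^γ 1_{A₁}]`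
both converge to `θ²/((γ+1)(γ+2))`. -/
theorem stmt_9
    {d : ℕ} {Ω : Type*} [MeasureSpace Ω] [IsProbabilityMeasure (ℙ : Measure Ω)]
    (X Y : ℤ → Ω → Vec d)
    (hXm : ∀ j, Measurable (X j)) (hYm : ∀ j, Measurable (Y j))
    (hstat : Stationary X) (htail : IsTailProcess X Y)
    (hY0 : ∀ᵐ ω ∂ℙ, 1 < ‖Y 0 ω‖)
    (x : ℕ → ℝ) (r : ℕ → ℕ) (hR : condR X x r)
    (hDH : condDH X x r)
    (γ : ℝ) (hγ : 0 < γ)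
    (hlarge : Tendsto (fun n : ℕ => (r n : ℝ) ^ (γ + 1) * wseq X x n) atTop atTop)
    (hdep : (∃ ℓ : ℕ, LDep X ℓ) ∨
      ((fun n : ℕ => ∑ j ∈ Finset.Icc 1 (r n), (j : ℝ) ^ γ * betaCoef X j)
        =o[atTop] fun n : ℕ => (r n : ℝ) ^ (γ + 1) * (wseq X x n) ^ 2)) :
    Tendsto (fun n : ℕ =>
        (∫ ω in A1 X (x n) (r n),
            ((tmax X (x n) (r n) ω - tmin X (x n) (r n) ω : ℤ) : ℝ) ^ γ ∂ℙ) /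
          ((r n : ℝ) ^ (γ + 2) * (wseq X x n) ^ 2))
      atTop (𝓝 (theta Y ^ 2 / ((γ + 1) * (γ + 2)))) ∧
    Tendsto (fun n : ℕ =>
        (∫ ω in A1 X (x n) (r n), (Len X (x n) (r n) ω : ℝ) ^ γ ∂ℙ) /
          ((r n : ℝ) ^ (γ + 2) * (wseq X x n) ^ 2))
      atTop (𝓝 (theta Y ^ 2 / ((γ + 1) * (γ + 2)))) := by
  obtain ⟨κ, hκ, hsmall⟩ := exists_covariance_bound hXm hlarge hdep
  obtain ⟨hx, hr, -⟩ := hR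
  constructor
  · refine tendsto_setIntegral_A1 hXm hYm hstat htail hY0 hx hr hDH hγ hlarge hκ hsmall
      (g := fun j => (j : ℝ) ^ γ) (fun _ => le_rfl)
      (fun j => Real.rpow_le_rpow (Nat.cast_nonneg j) (by linarith) hγ.le) fun n ω _ j hj => ?_
    rw [hj, Int.cast_natCast]
  · refine tendsto_setIntegral_A1 hXm hYm hstat htail hY0 hx hr hDH hγ hlarge hκ hsmall
      (g := fun j => ((j : ℝ) + 1) ^ γ)
      (fun j => Real.rpow_le_rpow (Nat.cast_nonneg j) (by linarith) hγ.le) (fun _ => le_rfl)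
      fun n ω hω j hj => ?_
    have hω' : (excB (x n) (r n) fun i => X i ω).Nonempty := hω
    rw [Len, if_pos hω', hj]
    push_cast
    rfl

end ClusterPaper
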